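/- arXiv:2604.08873 — 4 statements merged into one kernel-verified Lean document; each statement's English description precedes it below -/
import Mathlib

section
/- Let a, b : ℝ → ℝ be differentiable functions with a(0) = b(0) = 0, and for s ∈ ℝ let A(s) be the 3×3 real matrix with rows (1, a(s), b(s)), (0, cos s, −sin s), (0, sin s, cos s). If A(s + t) = A(s)·A(t) for all s, t ∈ ℝ, then for all s ∈ ℝ: a(s) = a′(0)·sin s + b′(0)·(1 − cos s) and b(s) = a′(0)·(cos s − 1) + b′(0)·sin s. In particular, a(2π) = b(2π) = 0. -/
/-- A function determined by `f (s + t) = f t + u s * cos t + v s * sin t` with `u 0 = v 0 = 0`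
is the primitive of `p cos + q sin`, where `p` and `q` are the derivatives of `u` and `v` at `0`. -/
theorem eq_sin_add_one_sub_cos_of_add {f u v : ℝ → ℝ} {p q : ℝ} (hf : Differentiable ℝ f)
    (hf0 : f 0 = 0) (hu : HasDerivAt u p 0) (hv : HasDerivAt v q 0)
    (hadd : ∀ s t, f (s + t) = f t + u s * Real.cos t + v s * Real.sin t) (s : ℝ) :
    f s = p * Real.sin s + q * (1 - Real.cos s) := by
  have hderiv (t : ℝ) : HasDerivAt f (p * Real.cos t + q * Real.sin t) t := by
    have hshift : HasDerivAt (fun s => f (s + t)) (deriv f t) 0 :=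
      HasDerivAt.comp_add_const 0 t (by simpa using (hf t).hasDerivAt)
    have hsum : HasDerivAt (fun s => f (s + t)) (p * Real.cos t + q * Real.sin t) 0 := by
      simp only [hadd, add_assoc]
      exact ((hu.mul_const _).add (hv.mul_const _)).const_add (f t)
    exact hshift.unique hsum ▸ (hf t).hasDerivAt
  have hzero (t : ℝ) :
      HasDerivAt (fun x => f x - (p * Real.sin x + q * (1 - Real.cos x))) 0 t := by
    refine ((hderiv t).sub (((Real.hasDerivAt_sin t).const_mul p).add
      (((Real.hasDerivAt_cos t).const_sub 1).const_mul q))).congr_deriv ?_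
    ring
  have hconst := is_const_of_deriv_eq_zero (fun t => (hzero t).differentiableAt)
    (fun t => (hzero t).deriv) s 0
  simp only [hf0, Real.sin_zero, Real.cos_zero] at hconst
  linarith

/-- If `A(s)` with rows `(1, a s, b s)`, `(0, cos s, −sin s)`, `(0, sin s, cos s)`
satisfies `A(s+t) = A(s)·A(t)` and `a(0) = b(0) = 0`, then
`a(s) = a'(0) sin s + b'(0)(1 − cos s)` and `b(s) = a'(0)(cos s − 1) + b'(0) sin s`;
in particular `a(2π) = b(2π) = 0`. -/
theorem stmt_7 (a b : ℝ → ℝ) (ha : Differentiable ℝ a) (hb : Differentiable ℝ b)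
    (ha0 : a 0 = 0) (hb0 : b 0 = 0)
    (hgrp : ∀ s t : ℝ,
      (!![1, a (s + t), b (s + t);
          0, Real.cos (s + t), -Real.sin (s + t);
          0, Real.sin (s + t), Real.cos (s + t)] : Matrix (Fin 3) (Fin 3) ℝ) =
        !![1, a s, b s; 0, Real.cos s, -Real.sin s; 0, Real.sin s, Real.cos s] *
        !![1, a t, b t; 0, Real.cos t, -Real.sin t; 0, Real.sin t, Real.cos t]) :
    (∀ s : ℝ,
      a s = deriv a 0 * Real.sin s + deriv b 0 * (1 - Real.cos s) ∧
      b s = deriv a 0 * (Real.cos s - 1) + deriv b 0 * Real.sin s) ∧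
    a (2 * Real.pi) = 0 ∧ b (2 * Real.pi) = 0 := by
  have haddA (s t : ℝ) : a (s + t) = a t + a s * Real.cos t + b s * Real.sin t := by
    simpa [Matrix.mul_apply, Fin.sum_univ_three] using congrFun (congrFun (hgrp s t) 0) 1
  have haddB (s t : ℝ) : b (s + t) = b t + b s * Real.cos t + (-a s) * Real.sin t := by
    have h := congrFun (congrFun (hgrp s t) 0) 2
    simp [Matrix.mul_apply, Fin.sum_univ_three] at h
    linarith
  have hda := (ha 0).hasDerivAt
  have hdb := (hb 0).hasDerivAt
  have hA := eq_sin_add_one_sub_cos_of_add ha ha0 hda hdb haddA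
  have hB := eq_sin_add_one_sub_cos_of_add hb hb0 hdb hda.neg haddB
  refine ⟨fun s => ⟨hA s, ?_⟩, by simp [hA], by simp [hB]⟩
  rw [hB s]
  ring
end

section
/- Let β : ℝ³ → (ℝ³)* be a C¹ map into the dual space (a 1-form with variable coefficients), let X : ℝ³ → ℝ³ be a C¹ vector field satisfying β(x)(X(x)) = 0 for all x ∈ ℝ³, and let φ : ℝ × ℝ³ → ℝ³ be a C² map satisfying ∂φ/∂s(s, x) = X(φ(s, x)) for all (s, x). Let p : ℝ → ℝ³ be a C¹ curve. Define w(s, t) = ∂/∂t [φ(s, p(t))] and κ(s, t) = β(φ(s, p(t)))(w(s, t)). Then for all (s, t): ∂κ/∂s(s, t) = dβ(φ(s, p(t)))(X(φ(s, p(t))), w(s, t)), where dβ(x)(u, v) := (Dβ(x)u)(v) − (Dβ(x)v)(u) and Dβ(x) denotes the Fréchet derivative of β at x. -/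
section FlowVariation

variable {E : Type*} [NormedAddCommGroup E] [NormedSpace ℝ E]

/-- Differentiating `β X = 0` in the direction `v`. -/
theorem fderiv_form_apply_add_eq_zero {β : E → E →L[ℝ] ℝ} {X : E → E} {x : E}
    (hβ : DifferentiableAt ℝ β x) (hX : DifferentiableAt ℝ X x)
    (hβX : ∀ y, β y (X y) = 0) (v : E) :
    fderiv ℝ β x v (X x) + β x (fderiv ℝ X x v) = 0 := by
  have h := hβ.hasFDerivAt.clm_apply hX.hasFDerivAt
  simp only [hβX] at h
  have h0 := congrArg (fun L : E →L[ℝ] ℝ => L v) (h.unique (hasFDerivAt_const (0 : ℝ) x))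
  simpa [add_comm] using h0

theorem hasDerivAt_partial_fst {φ : ℝ × E → E} {s : ℝ} {x : E}
    (hφ : DifferentiableAt ℝ φ (s, x)) :
    HasDerivAt (fun s' => φ (s', x)) (fderiv ℝ φ (s, x) (1, 0)) s :=
  hφ.hasFDerivAt.comp_hasDerivAt s ((hasDerivAt_id s).prodMk (hasDerivAt_const s x))

theorem hasDerivAt_comp_curve_snd {φ : ℝ × E → E} {p : ℝ → E} {s t : ℝ}
    (hφ : DifferentiableAt ℝ φ (s, p t)) (hp : DifferentiableAt ℝ p t) :
    HasDerivAt (fun t' => φ (s, p t')) (fderiv ℝ φ (s, p t) (0, deriv p t)) t :=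
  hφ.hasFDerivAt.comp_hasDerivAt t ((hasDerivAt_const t s).prodMk hp.hasDerivAt)

/-- The variational equation of the flow of `X`: the derivative of the flow in a fixed spatial
direction `v` evolves by the linearization of `X`. -/
theorem hasDerivAt_fderiv_flow_apply {X : E → E} {φ : ℝ × E → E}
    (hX : Differentiable ℝ X) (hφ : ContDiff ℝ 2 φ)
    (hflow : ∀ s x, deriv (fun s' => φ (s', x)) s = X (φ (s, x))) (s : ℝ) (x v : E) :
    HasDerivAt (fun s' => fderiv ℝ φ (s', x) (0, v))
      (fderiv ℝ X (φ (s, x)) (fderiv ℝ φ (s, x) (0, v))) s := by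
  have hφd : Differentiable ℝ φ := hφ.differentiable (by norm_num)
  have hφ' : Differentiable ℝ (fderiv ℝ φ) :=
    (hφ.fderiv_right (m := 1) (by norm_num)).differentiable (by norm_num)
  have hD := (hφ' (s, x)).hasFDerivAt
  have hfst : (fun y => fderiv ℝ φ y (1, 0)) = fun y => X (φ y) := by
    ext1 ⟨s', x'⟩
    rw [← hflow, (hasDerivAt_partial_fst (hφd (s', x'))).deriv]
  have hmixed : fderiv ℝ (fderiv ℝ φ) (s, x) (0, v) (1, 0) =
      fderiv ℝ X (φ (s, x)) (fderiv ℝ φ (s, x) (0, v)) := by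
    have hD1 := (ContinuousLinearMap.apply ℝ E ((1 : ℝ), (0 : E))).hasFDerivAt.comp (s, x) hD
    have hXφ : HasFDerivAt (fun y => fderiv ℝ φ y (1, 0))
        (fderiv ℝ X (φ (s, x)) ∘L fderiv ℝ φ (s, x)) (s, x) := by
      rw [hfst]
      exact (hX (φ (s, x))).hasFDerivAt.comp (s, x) (hφd (s, x)).hasFDerivAt
    exact congrArg (fun L : ℝ × E →L[ℝ] E => L (0, v)) (hD1.unique hXφ)
  rw [← hmixed, ← second_derivative_symmetric (fun y => (hφd y).hasFDerivAt) hD (1, 0) (0, v)]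
  have hs := hD.comp_hasDerivAt s ((hasDerivAt_id s).prodMk (hasDerivAt_const s x))
  exact (ContinuousLinearMap.apply ℝ E ((0 : ℝ), v)).hasFDerivAt.comp_hasDerivAt s hs

end FlowVariation


/-- the structure equation `∂κ/∂s = dβ(X, w)` for the holonomy coefficient
`κ(s,t) = β(φ(s, p t))(w(s,t))`, `w(s,t) = ∂/∂t φ(s, p t)`, along the flow `φ` of a vector
field `X` tangent to `ker β`, where `dβ(x)(u,v) = (Dβ(x)u)(v) − (Dβ(x)v)(u)`. -/
theorem stmt_8
    (β : EuclideanSpace ℝ (Fin 3) → (EuclideanSpace ℝ (Fin 3) →L[ℝ] ℝ))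
    (X : EuclideanSpace ℝ (Fin 3) → EuclideanSpace ℝ (Fin 3))
    (φ : ℝ × EuclideanSpace ℝ (Fin 3) → EuclideanSpace ℝ (Fin 3))
    (p : ℝ → EuclideanSpace ℝ (Fin 3))
    (hβ : ContDiff ℝ 1 β) (hX : ContDiff ℝ 1 X) (hφ : ContDiff ℝ 2 φ)
    (hp : ContDiff ℝ 1 p)
    (hβX : ∀ x, β x (X x) = 0)
    (hflow : ∀ s x, deriv (fun s' => φ (s', x)) s = X (φ (s, x))) :
    ∀ s t : ℝ,
      deriv (fun s' => β (φ (s', p t)) (deriv (fun t' => φ (s', p t')) t)) s =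
        fderiv ℝ β (φ (s, p t)) (X (φ (s, p t))) (deriv (fun t' => φ (s, p t')) t) -
        fderiv ℝ β (φ (s, p t)) (deriv (fun t' => φ (s, p t')) t) (X (φ (s, p t))) := by
  intro s t
  have hφd : Differentiable ℝ φ := hφ.differentiable (by norm_num)
  have hβd : Differentiable ℝ β := hβ.differentiable (by norm_num)
  have hXd : Differentiable ℝ X := hX.differentiable (by norm_num)
  have hpd : Differentiable ℝ p := hp.differentiable (by norm_num)
  have hw : ∀ s', deriv (fun t' => φ (s', p t')) t = fderiv ℝ φ (s', p t) (0, deriv p t) :=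
    fun s' => (hasDerivAt_comp_curve_snd (hφd (s', p t)) (hpd t)).deriv
  simp only [hw]
  have hs : HasDerivAt (fun s' => φ (s', p t)) (X (φ (s, p t))) s := by
    rw [← hflow]
    exact (hasDerivAt_partial_fst (hφd (s, p t))).differentiableAt.hasDerivAt
  have hβs := (hβd (φ (s, p t))).hasFDerivAt.comp_hasDerivAt s hs
  have hκ := hβs.clm_apply (hasDerivAt_fderiv_flow_apply hXd hφ hflow s (p t) (deriv p t))
  have hzero := fderiv_form_apply_add_eq_zero (hβd (φ (s, p t))) (hXd _) hβX
    (fderiv ℝ φ (s, p t) (0, deriv p t))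
  refine hκ.deriv.trans ?_
  simp only [Function.comp_apply]
  linarith
end

section
/- Let K be a nonempty compact topological space and let h : K × ℝ → ℝ be a continuous function such that the map (z, θ) ↦ (z, h(z, θ)) is a homeomorphism of K × ℝ onto itself and, for each z ∈ K, the function θ ↦ h(z, θ) is strictly monotonically increasing. Then for any functions z : [0, ∞) → K and θ : [0, ∞) → ℝ, one has θ(t) → +∞ as t → ∞ if and only if h(z(t), θ(t)) → +∞ as t → ∞. -/
open Filter

/-- A continuous real function on `K × ℝ`, `K` compact, is bounded above on each slice. -/
theorem exists_forall_slice_le {K : Type*} [TopologicalSpace K] [CompactSpace K]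
    {f : K × ℝ → ℝ} (hf : Continuous f) (a : ℝ) : ∃ C, ∀ z, f (z, a) ≤ C := by
  have hslice : Continuous fun z => f (z, a) := by fun_prop
  obtain ⟨C, hC⟩ := (isCompact_range hslice).bddAbove
  exact ⟨C, fun z => hC ⟨z, rfl⟩⟩

/-- if `(z, θ) ↦ (z, h(z, θ))` is a fiber-preserving homeomorphism of `K × ℝ`
(`K` nonempty compact) which is strictly increasing on each fiber, then for any
`z : [0,∞) → K`, `θ : [0,∞) → ℝ`, one has `θ(t) → +∞` iff `h(z(t), θ(t)) → +∞`. -/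
theorem stmt_10 (K : Type*) [TopologicalSpace K] [CompactSpace K] [Nonempty K]
    (h : K × ℝ → ℝ) (hcont : Continuous h)
    (hhomeo : ∃ e : (K × ℝ) ≃ₜ (K × ℝ), ∀ q : K × ℝ, e q = (q.1, h q))
    (hmono : ∀ z : K, StrictMono fun θ : ℝ => h (z, θ)) :
    ∀ (z : NNReal → K) (θ : NNReal → ℝ),
      Tendsto θ atTop atTop ↔ Tendsto (fun t => h (z t, θ t)) atTop atTop := by
  intro z θ
  constructor
  · intro hθ
    obtain ⟨e, he⟩ := hhomeo
    refine tendsto_atTop.2 fun M => ?_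
    obtain ⟨C, hC⟩ := exists_forall_slice_le (continuous_snd.comp e.symm.continuous) M
    filter_upwards [hθ.eventually_ge_atTop C] with t ht
    have hinv := he (e.symm (z t, M))
    rw [e.apply_symm_apply, Prod.mk.injEq] at hinv
    have hpair : e.symm (z t, M) = (z t, (e.symm (z t, M)).2) := Prod.ext hinv.1.symm rfl
    calc M = h (e.symm (z t, M)) := hinv.2
      _ = h (z t, (e.symm (z t, M)).2) := congrArg h hpair
      _ ≤ h (z t, θ t) := (hmono (z t)).monotone ((hC (z t)).trans ht)
  · intro hh
    refine tendsto_atTop.2 fun M => ?_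
    obtain ⟨C, hC⟩ := exists_forall_slice_le hcont M
    filter_upwards [hh.eventually_ge_atTop C] with t ht
    exact (hmono (z t)).le_iff_le.1 ((hC (z t)).trans ht)
end

section
/- Let u, θ : [0, ∞) → ℝ be differentiable functions with u(s) > 0 for all s ≥ 0, and suppose there are constants k > 0 and ĉ > 0 such that for all s ≥ 0: θ′(s) ≥ k·u(s) and −ĉ·u(s)² ≤ u′(s) ≤ 0. Then θ(s) − θ(0) ≥ (k/ĉ)·(log u(0) − log u(s)) for all s ≥ 0. Consequently, if u(s) → 0 as s → ∞, then θ(s) → +∞ as s → ∞. -/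
open Filter

/-- if `u > 0` on `[0,∞)`, `θ' ≥ k·u` and `−ĉ·u² ≤ u' ≤ 0` there, then
`θ(s) − θ(0) ≥ (k/ĉ)(log u(0) − log u(s))`; consequently `u → 0` forces `θ → +∞`. -/
theorem stmt_12 (u θ : ℝ → ℝ) (k c : ℝ) (hk : 0 < k) (hc : 0 < c)
    (hu : ∀ s : ℝ, 0 ≤ s → DifferentiableAt ℝ u s)
    (hθ : ∀ s : ℝ, 0 ≤ s → DifferentiableAt ℝ θ s)
    (hupos : ∀ s : ℝ, 0 ≤ s → 0 < u s)
    (hθ' : ∀ s : ℝ, 0 ≤ s → k * u s ≤ deriv θ s)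
    (hu' : ∀ s : ℝ, 0 ≤ s → -c * u s ^ 2 ≤ deriv u s ∧ deriv u s ≤ 0) :
    (∀ s : ℝ, 0 ≤ s →
      (k / c) * (Real.log (u 0) - Real.log (u s)) ≤ θ s - θ 0) ∧
    (Tendsto u atTop (nhds 0) → Tendsto θ atTop atTop) := by
  have hderiv : ∀ s : ℝ, 0 ≤ s →
      HasDerivAt (fun t => θ t + (k / c) * Real.log (u t))
        (deriv θ s + (k / c) * (deriv u s / u s)) s := fun s hs =>
    (hθ s hs).hasDerivAt.add
      (((hu s hs).hasDerivAt.log (hupos s hs).ne').const_mul (k / c))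
  have hmono : MonotoneOn (fun t => θ t + (k / c) * Real.log (u t)) (Set.Ici 0) := by
    refine monotoneOn_of_deriv_nonneg (convex_Ici 0)
      (fun s hs => (hderiv s hs).continuousAt.continuousWithinAt)
      (fun s hs => (hderiv s (interior_subset hs)).differentiableAt.differentiableWithinAt)
      fun s hs => ?_
    have hs : 0 ≤ s := Set.mem_Ici.mp (interior_subset hs)
    rw [(hderiv s hs).deriv]
    have hlog : -c * u s ≤ deriv u s / u s := by
      rw [le_div_iff₀ (hupos s hs)]
      linarith [(hu' s hs).1]
    have hscaled := mul_le_mul_of_nonneg_left hlog (div_pos hk hc).le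
    have hcancel : k / c * (-c * u s) = -(k * u s) := by
      field_simp
    linarith [hθ' s hs]
  have hbound : ∀ s : ℝ, 0 ≤ s →
      (k / c) * (Real.log (u 0) - Real.log (u s)) ≤ θ s - θ 0 := by
    intro s hs
    have h := hmono (Set.mem_Ici.mpr le_rfl) (Set.mem_Ici.mpr hs) hs
    dsimp only at h
    linarith
  refine ⟨hbound, fun hlim => ?_⟩
  have hlog : Tendsto (fun s => Real.log (u s)) atTop atBot := by
    refine Real.tendsto_log_nhdsGT_zero.comp (tendsto_nhdsWithin_iff.mpr ⟨hlim, ?_⟩)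
    filter_upwards [eventually_ge_atTop 0] with s hs using hupos s hs
  have hlower : Tendsto
      (fun s => θ 0 + (k / c) * (Real.log (u 0) + -Real.log (u s))) atTop atTop :=
    tendsto_atTop_add_const_left _ _ <| Tendsto.const_mul_atTop (div_pos hk hc) <|
      tendsto_atTop_add_const_left _ _ (tendsto_neg_atBot_atTop.comp hlog)
  refine tendsto_atTop_mono' _ ?_ hlower
  filter_upwards [eventually_ge_atTop 0] with s hs
  linarith [hbound s hs]
end
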